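/- Suppose 𝔉 is an incompatible 2,3-split system on a finite multiset 𝓜 containing k ≥ 3 splits, in which every split has multiplicity 1, such that every proper subset of 𝔉 is compatible. Then Δ(𝓜) ≥ k − 3. -/

import Mathlib

open scoped Classical

/-- A split of a multiset `M`: an unordered pair of nonempty submultisets of `M`
whose multiset union is `M`. -/
def IsSplit {X : Type} (M : Multiset X) (S : Sym2 (Multiset X)) : Prop :=
  ∃ A B : Multiset X, S = s(A, B) ∧ A ≠ 0 ∧ B ≠ 0 ∧ A + B = M

/-- A split system on `M`: a multiset of splits of `M`. -/
def IsSplitSystem {X : Type} (M : Multiset X) (𝔖 : Multiset (Sym2 (Multiset X))) : Prop :=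
  ∀ S ∈ 𝔖, IsSplit M S

/-- An `M`-tree: a finite tree whose vertices are labelled by submultisets of `M`
such that (M1) the multiset union of all labels is `M`, and (M2) every vertex of
degree 1 or 2 has a nonempty label. -/
structure MTree (X : Type) (M : Multiset X) where
  n : ℕ
  G : SimpleGraph (Fin n)
  connected : G.Connected
  acyclic : G.IsAcyclic
  label : Fin n → Multiset X
  m1 : ∑ v, label v = M
  m2 : ∀ v, G.degree v = 1 ∨ G.degree v = 2 → label v ≠ 0

namespace MTree

variable {X : Type} {M : Multiset X}

/-- The part of the split induced by the edge `{u, v}` lying on the side of `u`: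
the multiset union of the labels of the vertices in the connected component of `u`
after deleting the edge `{u, v}`. -/
noncomputable def part (T : MTree X M) (u v : Fin T.n) : Multiset X :=
  ∑ w ∈ Finset.univ.filter (fun w => (T.G.deleteEdges {s(u, v)}).Reachable u w), T.label w

/-- The multiset of splits represented by an `M`-tree: the splits induced by its edges. -/
noncomputable def splits (T : MTree X M) : Multiset (Sym2 (Multiset X)) :=
  T.G.edgeFinset.val.map
    (Sym2.lift ⟨fun u v => s(T.part u v, T.part v u), fun u v => Sym2.eq_swap⟩)

end MTree

/-- A split system on `M` is compatible if some `M`-tree represents it. -/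
def Compatible {X : Type} (M : Multiset X) (𝔖 : Multiset (Sym2 (Multiset X))) : Prop :=
  ∃ T : MTree X M, T.splits = 𝔖

/-- `Δ(M) = Σ_{x ∈ X} (M(x) - 1)`. -/
def delta {X : Type} [DecidableEq X] (M : Multiset X) : ℕ :=
  ∑ x ∈ M.toFinset, (M.count x - 1)

/-- The split system `{S₁, …, Sₙ}` determined by an indexed family of ordered splits,
where split `i` has parts `P i true` and `P i false`. -/
def splitSystemOf {X : Type} {n : ℕ} (P : Fin n → Bool → Multiset X) :
    Multiset (Sym2 (Multiset X)) :=
  (Finset.univ.val : Multiset (Fin n)).map fun i => s(P i true, P i false)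

/-- The arcs of the split-containment graph `Γ(𝔖)`: its vertices are the pairs
`(i, b)` (representing the pair `(P i b, Sᵢ)` of a part of the split `Sᵢ` together
with `Sᵢ`), and there is an arc from `(i, b)` to `(j, c)` iff `i ≠ j` and
`P i b ⊊ P j c` as multisets. -/
def GammaArc {X : Type} {n : ℕ} (P : Fin n → Bool → Multiset X)
    (u v : Fin n × Bool) : Prop :=
  u.1 ≠ v.1 ∧ P u.1 u.2 < P v.1 v.2

/-- A thin subgraph of `Γ(𝔖)`: a spanning subgraph `G` of `Γ(𝔖)` such that for all
distinct `i, j` the restriction of `G` to the four vertices coming from `Sᵢ` and `Sⱼ`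
has exactly two arcs, of the form `((C,Sᵢ),(D,Sⱼ))` and `((D̄,Sⱼ),(C̄,Sᵢ))`. -/
def IsThinSubgraph {X : Type} {n : ℕ} (P : Fin n → Bool → Multiset X)
    (G : Fin n × Bool → Fin n × Bool → Prop) : Prop :=
  (∀ u v, G u v → GammaArc P u v) ∧
  ∀ i j : Fin n, i ≠ j → ∃ b c : Bool, ∀ b' c' : Bool,
    (G (i, b') (j, c') ↔ b' = b ∧ c' = c) ∧
    (G (j, c') (i, b') ↔ c' = !c ∧ b' = !b)

/-- An arc `(u, v)` of a digraph `G` is critical if the only directed path in `G`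
from `u` to `v` is the arc itself. -/
def IsCriticalArc {V : Type} (G : V → V → Prop) (u v : V) : Prop :=
  G u v ∧ ¬ ∃ w, G u w ∧ w ≠ v ∧ Relation.TransGen G w v

/-- A (thin) subgraph `G` of `Γ(𝔖)` is consistent if for every vertex `(A, Sᵢ)` of `G`,
the multiset union of the parts `B` over all vertices `(B, Sⱼ)` such that
`((B,Sⱼ),(A,Sᵢ))` is a critical arc of `G` is a submultiset of `A`. -/
def IsConsistent {X : Type} {n : ℕ} (P : Fin n → Bool → Multiset X)
    (G : Fin n × Bool → Fin n × Bool → Prop) : Prop :=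
  ∀ u : Fin n × Bool,
    (∑ w ∈ Finset.univ.filter (fun w => IsCriticalArc G w u), P w.1 w.2) ≤ P u.1 u.2

/-- A part `A` of a split `A|Ā ∈ 𝔖` is a terminal set of `𝔖` if for every split
`B|B̄` of `𝔖` other than (this occurrence of) `A|Ā`, neither `B ⊊ A` nor `B̄ ⊊ A`. -/
def IsTerminal {X : Type} [DecidableEq X] (M : Multiset X)
    (𝔖 : Multiset (Sym2 (Multiset X))) (A : Multiset X) : Prop :=
  s(A, M - A) ∈ 𝔖 ∧ ∀ T ∈ 𝔖.erase s(A, M - A), ∀ B ∈ T, ¬ B < A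

/-- A terminal set `A` of `𝔖` is a superterminal set if in addition, for every split
`B|B̄` of `𝔖` other than `A|Ā`, exactly one of `A ⊊ B`, `A ⊊ B̄` holds. -/
def IsSuperterminal {X : Type} [DecidableEq X] (M : Multiset X)
    (𝔖 : Multiset (Sym2 (Multiset X))) (A : Multiset X) : Prop :=
  IsTerminal M 𝔖 A ∧
    ∀ T ∈ 𝔖.erase s(A, M - A), ∀ B C : Multiset X, T = s(B, C) → (A < B ↔ ¬ A < C)

/-- Two splits are compatible if they have parts `A ∈ S₁`, `B ∈ S₂` with `A ∩ B = ∅`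
(multiset intersection). -/
def SplitPairCompatible {X : Type} [DecidableEq X] (S₁ S₂ : Sym2 (Multiset X)) : Prop :=
  ∃ A ∈ S₁, ∃ B ∈ S₂, A ∩ B = 0

/-- A split system is pairwise compatible if any two of its splits are compatible. -/
def PairwiseCompatible {X : Type} [DecidableEq X] (𝔖 : Multiset (Sym2 (Multiset X))) : Prop :=
  ∀ S₁ ∈ 𝔖, ∀ S₂ ∈ 𝔖.erase S₁, SplitPairCompatible S₁ S₂

/-- The size of a split `A|B` is `min {|A|, |B|}`. -/
def splitSize {X : Type} : Sym2 (Multiset X) → ℕ :=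
  Sym2.lift ⟨fun A B => min A.card B.card, fun A B => min_comm _ _⟩

/-- Isomorphism of `M`-trees: a graph isomorphism preserving the labels. -/
def MTreeIso {X : Type} {M : Multiset X} (T T' : MTree X M) : Prop :=
  ∃ φ : Fin T.n ≃ Fin T'.n,
    (∀ u v, T.G.Adj u v ↔ T'.G.Adj (φ u) (φ v)) ∧ ∀ v, T'.label (φ v) = T.label v

/-- Isomorphism of digraphs. -/
def DigraphIso {V W : Type} (R : V → V → Prop) (Q : W → W → Prop) : Prop :=
  ∃ φ : V ≃ W, ∀ a b, R a b ↔ Q (φ a) (φ b)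

/-- The digraph `D₁` on the four vertices `v = 0`, `w = 1`, `p = 2`, `q = 3`,
with arcs `(v,p)` and `(q,w)`. -/
def D1 : Fin 4 → Fin 4 → Prop := fun a b => (a = 0 ∧ b = 2) ∨ (a = 3 ∧ b = 1)

/-- The digraph `D₂` on the four vertices `v = 0`, `w = 1`, `p = 2`, `q = 3`,
with arcs `(v,p)`, `(p,w)`, `(v,q)` and `(q,w)`. -/
def D2 : Fin 4 → Fin 4 → Prop :=
  fun a b => (a = 0 ∧ b = 2) ∨ (a = 2 ∧ b = 1) ∨ (a = 0 ∧ b = 3) ∨ (a = 3 ∧ b = 1)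

/-- Isomorphism of subgraphs of `Γ(𝔖)`: a digraph isomorphism mapping each vertex
`(A, Sᵢ)` to a vertex `(B, Sⱼ)` with `A = B`. -/
def SubgraphIso {X : Type} {n : ℕ} (P : Fin n → Bool → Multiset X)
    (G G' : Fin n × Bool → Fin n × Bool → Prop) : Prop :=
  ∃ φ : Fin n × Bool ≃ Fin n × Bool,
    (∀ u v, G u v ↔ G' (φ u) (φ v)) ∧ ∀ u, P (φ u).1 (φ u).2 = P u.1 u.2

section Packing

variable {X : Type} [DecidableEq X]

/-- The pairs in `Q` can be nested injectively inside triples of `F` so that the remaining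
members of `F` sum to a submultiset of `M`. -/
def IsPackable (M : Multiset X) (F : Finset (Multiset X)) : Prop :=
  ∃ (Q : Finset (Multiset X)) (g : Multiset X → Multiset X), Q ⊆ F ∧
    (∀ A ∈ Q, A.card = 2 ∧ g A ∈ F ∧ (g A).card = 3 ∧ A ≤ g A) ∧
    Set.InjOn g Q ∧ ∑ A ∈ F \ Q, A ≤ M

lemma IsPackable.of_disjoint {M : Multiset X} {F W : Finset (Multiset X)} (hWF : W ⊆ F)
    (h₁ : IsPackable M W) (h₂ : IsPackable M (F \ W))
    (hd : ∀ A ∈ W, ∀ B ∈ F \ W, Disjoint A B) : IsPackable M F := by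
  obtain ⟨Q₁, g₁, hQ₁, hg₁, hi₁, hs₁⟩ := h₁
  obtain ⟨Q₂, g₂, hQ₂, hg₂, hi₂, hs₂⟩ := h₂
  have hnot : ∀ A ∈ Q₂, A ∉ W := fun A hA => (Finset.mem_sdiff.1 (hQ₂ hA)).2
  refine ⟨Q₁ ∪ Q₂, fun A => if A ∈ W then g₁ A else g₂ A, ?_, ?_, ?_, ?_⟩
  · exact Finset.union_subset (hQ₁.trans hWF) (hQ₂.trans Finset.sdiff_subset)
  · intro A hA
    rcases Finset.mem_union.1 hA with h | h
    · have := hg₁ A h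
      simp only [hQ₁ h, if_true]
      exact ⟨this.1, hWF this.2.1, this.2.2⟩
    · have := hg₂ A h
      simp only [hnot A h, if_false]
      exact ⟨this.1, (Finset.mem_sdiff.1 this.2.1).1, this.2.2⟩
  · intro A hA B hB hAB
    simp only [Finset.coe_union, Set.mem_union, Finset.mem_coe] at hA hB
    rcases hA with hA | hA <;> rcases hB with hB | hB
    · simp only [hQ₁ hA, hQ₁ hB, if_true] at hAB
      exact hi₁ hA hB hAB
    · simp only [hQ₁ hA, hnot B hB, if_true, if_false] at hAB
      have h1 := (hg₁ A hA).2.1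
      have h2 := (Finset.mem_sdiff.1 (hg₂ B hB).2.1).2
      exact absurd (hAB ▸ h1) h2
    · simp only [hQ₁ hB, hnot A hA, if_true, if_false] at hAB
      have h1 := (hg₁ B hB).2.1
      have h2 := (Finset.mem_sdiff.1 (hg₂ A hA).2.1).2
      exact absurd (hAB ▸ h1) h2
    · simp only [hnot A hA, hnot B hB, if_false] at hAB
      exact hi₂ hA hB hAB
  · have hsplit : F \ (Q₁ ∪ Q₂) = (W \ Q₁) ∪ ((F \ W) \ Q₂) := by
      ext A
      have := @hQ₁ A; have := @hQ₂ A; have := @hWF A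
      simp only [Finset.mem_sdiff, Finset.mem_union] at *
      tauto
    rw [hsplit, Finset.sum_union]
    · rw [Multiset.le_iff_count] at *
      intro x
      rw [Multiset.count_add]
      by_cases hx : ∃ A ∈ W, x ∈ A
      · obtain ⟨A, hA, hxA⟩ := hx
        have : Multiset.count x (∑ B ∈ (F \ W) \ Q₂, B) = 0 := by
          rw [Multiset.count_sum']
          refine Finset.sum_eq_zero fun B hB => Multiset.count_eq_zero.2 fun hxB => ?_
          exact Multiset.disjoint_left.1 (hd A hA B (Finset.mem_sdiff.1 hB).1) hxA hxB
        rw [this]; exact hs₁ x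
      · have : Multiset.count x (∑ B ∈ W \ Q₁, B) = 0 := by
          rw [Multiset.count_sum']
          refine Finset.sum_eq_zero fun B hB => Multiset.count_eq_zero.2 fun hxB => ?_
          exact hx ⟨B, (Finset.mem_sdiff.1 hB).1, hxB⟩
        rw [this, zero_add]; exact hs₂ x
    · refine Finset.disjoint_left.2 fun A hA hA' => ?_
      exact (Finset.mem_sdiff.1 (Finset.mem_sdiff.1 hA').1).2 (Finset.mem_sdiff.1 hA).1

/-- The graph joining two distinct members of `F` when one is contained in the other. -/
def containmentGraph (F : Finset (Multiset X)) : SimpleGraph (Multiset X) where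
  Adj A B := A ∈ F ∧ B ∈ F ∧ A ≠ B ∧ (A ≤ B ∨ B ≤ A)
  symm := ⟨fun _ _ h => ⟨h.2.1, h.1, h.2.2.1.symm, h.2.2.2.symm⟩⟩
  loopless := ⟨fun _ h => h.2.2.1 rfl⟩

/-- The connected component of `A` in the containment graph of `F`. -/
noncomputable def containmentClass (F : Finset (Multiset X)) (A : Multiset X) :
    (containmentGraph F).ConnectedComponent :=
  (containmentGraph F).connectedComponentMk A

lemma containmentClass_eq {F : Finset (Multiset X)} {A B : Multiset X} (hA : A ∈ F)
    (hB : B ∈ F) (h : A ≤ B) : containmentClass F A = containmentClass F B := by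
  by_cases hAB : A = B
  · rw [hAB]
  · exact SimpleGraph.ConnectedComponent.sound
      (SimpleGraph.Adj.reachable (⟨hA, hB, hAB, Or.inl h⟩ : (containmentGraph F).Adj A B))

lemma card_biUnion_insert_le {W : Finset (Multiset X)} {B C : Multiset X}
    (h : ∀ x ∈ B, x ∈ C ∨ ∃ A ∈ W, x ∈ A) :
    ((insert B W).biUnion Multiset.toFinset).card ≤
      (W.biUnion Multiset.toFinset).card + C.card := by
  have hsub : (insert B W).biUnion Multiset.toFinset ⊆
      W.biUnion Multiset.toFinset ∪ C.toFinset := by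
    intro x hx
    simp only [Finset.biUnion_insert, Finset.mem_union, Multiset.mem_toFinset,
      Finset.mem_biUnion] at hx ⊢
    rcases hx with hx | hx
    · exact (h x hx).symm
    · exact Or.inl hx
  exact (Finset.card_le_card hsub).trans ((Finset.card_union_le _ _).trans
    (Nat.add_le_add_left (Multiset.toFinset_card_le _) _))

lemma exists_card_support_le {F : Finset (Multiset X)}
    (hF : ∀ A ∈ F, A.card = 2 ∨ A.card = 3)
    (hc : ∀ W ⊆ F, W.Nonempty → W ≠ F → ∃ A ∈ W, ∃ B ∈ F \ W, ¬ Disjoint A B)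
    (n : ℕ) (hn : 1 ≤ n) : n ≤ F.card → ∃ W ⊆ F, W.card = n ∧
      (W.biUnion Multiset.toFinset).card ≤
        (W.filter fun A => A.card = 3).card + (W.image (containmentClass F)).card + 1 := by
  induction n, hn using Nat.le_induction with
  | base =>
    intro h1
    obtain ⟨A, hA⟩ := Finset.card_pos.1 h1
    refine ⟨{A}, Finset.singleton_subset_iff.2 hA, Finset.card_singleton A, ?_⟩
    have h2 := Multiset.toFinset_card_le A
    rw [Finset.singleton_biUnion, Finset.image_singleton, Finset.card_singleton,
      Finset.filter_singleton]
    rcases hF A hA with h | h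
    · omega
    · simp [h]; omega
  | succ n hn ih =>
    intro hle
    obtain ⟨W, hWF, hWn, hW⟩ := ih (by omega)
    have hWne : W.Nonempty := Finset.card_pos.1 (by omega)
    have hWF' : W ≠ F := by rintro rfl; omega
    by_cases hadj : ∃ A ∈ W, ∃ B ∈ F \ W, A ≤ B ∨ B ≤ A
    · obtain ⟨A, hA, B, hB, hAB⟩ := hadj
      obtain ⟨hBF, hBW⟩ := Finset.mem_sdiff.1 hB
      refine ⟨insert B W, Finset.insert_subset hBF hWF, by
        rw [Finset.card_insert_of_notMem hBW, hWn], ?_⟩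
      have himg : (W.image (containmentClass F)).card ≤
          ((insert B W).image (containmentClass F)).card :=
        Finset.card_le_card (Finset.image_subset_image (Finset.subset_insert _ _))
      have hne : A ≠ B := fun h => hBW (h ▸ hA)
      rcases hAB with hAB | hAB
      · have hlt : A.card < B.card := Multiset.card_lt_card (lt_of_le_of_ne hAB hne)
        have hB3 : B.card = 3 := by
          have := hF A (hWF hA); have := hF B hBF; omega
        have hA2 : A.card = 2 := by
          have := hF A (hWF hA); omega
        have h1 := card_biUnion_insert_le (W := W) (B := B) (C := B - A) (fun x hx => by
          rw [← tsub_add_cancel_of_le hAB, Multiset.mem_add] at hx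
          exact hx.imp id fun h => ⟨A, hA, h⟩)
        rw [Multiset.card_sub hAB] at h1
        rw [Finset.filter_insert, if_pos hB3, Finset.card_insert_of_notMem (by simp [hBW])]
        omega
      · have h1 := card_biUnion_insert_le (W := W) (B := B) (C := 0) (fun x hx =>
          Or.inr ⟨A, hA, Multiset.mem_of_le hAB hx⟩)
        rw [Multiset.card_zero] at h1
        have h2 : (W.filter fun A => A.card = 3).card ≤
            ((insert B W).filter fun A => A.card = 3).card :=
          Finset.card_le_card (Finset.filter_subset_filter _ (Finset.subset_insert _ _))
        omega
    · obtain ⟨A, hA, B, hB, hAB⟩ := hc W hWF hWne hWF'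
      obtain ⟨hBF, hBW⟩ := Finset.mem_sdiff.1 hB
      refine ⟨insert B W, Finset.insert_subset hBF hWF, by
        rw [Finset.card_insert_of_notMem hBW, hWn], ?_⟩
      have hclosed : ∀ C D, (containmentGraph F).Reachable C D → C ∈ W → D ∈ W := by
        intro C D hCD hC
        rw [SimpleGraph.reachable_iff_reflTransGen] at hCD
        induction hCD with
        | refl => exact hC
        | tail _ h ih =>
          by_contra hD
          exact hadj ⟨_, ih, _, Finset.mem_sdiff.2 ⟨h.2.1, hD⟩, h.2.2.2⟩
      have hnot : containmentClass F B ∉ W.image (containmentClass F) := by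
        intro h
        obtain ⟨C, hC, hCB⟩ := Finset.mem_image.1 h
        exact hBW (hclosed C B (SimpleGraph.ConnectedComponent.exact hCB) hC)
      rw [Finset.image_insert, Finset.card_insert_of_notMem hnot]
      rw [Multiset.disjoint_left] at hAB
      push Not at hAB
      obtain ⟨x, hxA, hxB⟩ := hAB
      have h1 := card_biUnion_insert_le (W := W) (B := B) (C := B.erase x) (fun y hy => by
        by_cases hyx : y = x
        · exact Or.inr ⟨A, hA, hyx ▸ hxA⟩
        · exact Or.inl ((Multiset.mem_erase_of_ne hyx).2 hy))
      rw [Multiset.card_erase_of_mem hxB] at h1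
      rw [Finset.filter_insert]
      rcases hF B hBF with h | h
      · rw [if_neg (by omega)]
        rw [h] at h1
        have : Nat.pred 2 = 1 := rfl
        omega
      · rw [if_pos h, Finset.card_insert_of_notMem (by simp [hBW])]
        rw [h] at h1
        have : Nat.pred 3 = 2 := rfl
        omega

lemma sum_count_le_card_add_delta {M : Multiset X} {S : Finset X} (hS : S ⊆ M.toFinset) :
    ∑ x ∈ S, M.count x ≤ S.card + delta M := by
  calc ∑ x ∈ S, M.count x ≤ ∑ x ∈ S, (1 + (M.count x - 1)) :=
        Finset.sum_le_sum fun x _ => by omega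
    _ = S.card + ∑ x ∈ S, (M.count x - 1) := by
        rw [Finset.sum_add_distrib, Finset.card_eq_sum_ones]
    _ ≤ S.card + delta M :=
        Nat.add_le_add_left (Finset.sum_le_sum_of_subset hS) _

lemma IsPackable.of_matched_class {M : Multiset X} {F Q N : Finset (Multiset X)}
    {g : Multiset X → Multiset X} {c : (containmentGraph F).ConnectedComponent}
    (hN : ∀ A, A ∈ N ↔ A ∈ F ∧ containmentClass F A = c ∧ A.card = 2) (hNQ : N ⊆ Q)
    (hg : ∀ A ∈ Q, A.card = 2 ∧ g A ∈ F ∧ (g A).card = 3 ∧ A ≤ g A)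
    (hi : Set.InjOn g Q) (h : IsPackable M (F \ N)) : IsPackable M F := by
  obtain ⟨Q', g', hQ', hg', hi', hs'⟩ := h
  have hnot : ∀ A ∈ Q', A ∉ N := fun A hA => (Finset.mem_sdiff.1 (hQ' hA)).2
  have hQF : ∀ A ∈ Q', A ∈ F := fun A hA => (Finset.mem_sdiff.1 (hQ' hA)).1
  have hNF : N ⊆ F := fun A hA => ((hN A).1 hA).1
  have key : ∀ A ∈ N, ∀ B ∈ Q', g A ≠ g' B := by
    intro A hA B hB hAB
    obtain ⟨-, h1, -, h2⟩ := hg A (hNQ hA)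
    obtain ⟨h0, h3, -, h4⟩ := hg' B hB
    refine hnot B hB ((hN B).2 ⟨hQF B hB, ?_, h0⟩)
    rw [containmentClass_eq (hQF B hB) (Finset.mem_sdiff.1 h3).1 h4, ← hAB,
      ← containmentClass_eq (hNF hA) h1 h2]
    exact ((hN A).1 hA).2.1
  refine ⟨N ∪ Q', fun A => if A ∈ N then g A else g' A, ?_, ?_, ?_, ?_⟩
  · exact Finset.union_subset hNF hQF
  · intro A hA
    rcases Finset.mem_union.1 hA with h | h
    · simp only [h, if_true]
      exact hg A (hNQ h)
    · have := hg' A h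
      simp only [hnot A h, if_false]
      exact ⟨this.1, (Finset.mem_sdiff.1 this.2.1).1, this.2.2⟩
  · intro A hA B hB hAB
    simp only [Finset.coe_union, Set.mem_union, Finset.mem_coe] at hA hB
    rcases hA with hA | hA <;> rcases hB with hB | hB
    · simp only [hA, hB, if_true] at hAB
      exact hi (hNQ hA) (hNQ hB) hAB
    · simp only [hA, hnot B hB, if_true, if_false] at hAB
      exact absurd hAB (key A hA B hB)
    · simp only [hB, hnot A hA, if_true, if_false] at hAB
      exact absurd hAB.symm (key B hB A hA)
    · simp only [hnot A hA, hnot B hB, if_false] at hAB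
      exact hi' hA hB hAB
  · have hsd : F \ (N ∪ Q') = (F \ N) \ Q' := by
      ext A
      simp only [Finset.mem_sdiff, Finset.mem_union]
      tauto
    rwa [hsd]

/-- The bound for a minimal unpackable family without pairs. -/
lemma card_le_delta_of_no_pairs {M : Multiset X} {F : Finset (Multiset X)}
    (hle : ∀ A ∈ F, A ≤ M) (hF : ∀ A ∈ F, A.card = 3) (hnot : ¬ IsPackable M F)
    (hmin : ∀ F' ⊂ F, IsPackable M F') : F.card ≤ delta M + 2 := by
  have hsum : ∀ F' ⊆ F, IsPackable M F' → ∑ A ∈ F', A ≤ M := by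
    rintro F' hF' ⟨Q, g, hQ, hg, -, hs⟩
    have : Q = ∅ := Finset.eq_empty_of_forall_notMem fun A hA => by
      have := (hg A hA).1; have := hF A (hF' (hQ hA)); omega
    rwa [this, Finset.sdiff_empty] at hs
  have hex : ∃ x, M.count x < ∑ A ∈ F, A.count x := by
    by_contra! h
    refine hnot ⟨∅, id, Finset.empty_subset _, by simp, by simp, ?_⟩
    rw [Finset.sdiff_empty, Multiset.le_iff_count]
    intro x
    rw [Multiset.count_sum']
    exact h x
  obtain ⟨x, hx⟩ := hex
  have hall : ∀ A ∈ F, x ∈ A := by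
    intro A hA
    by_contra hxA
    have h1 := hsum _ (Finset.erase_subset A F) (hmin _ (Finset.erase_ssubset hA))
    have h2 := Multiset.count_le_of_le x h1
    rw [Multiset.count_sum'] at h2
    rw [← Finset.add_sum_erase F _ hA, Multiset.count_eq_zero.2 hxA] at hx
    omega
  rcases F.eq_empty_or_nonempty with rfl | ⟨A, hA⟩
  · simp
  · have h1 := hsum _ (Finset.erase_subset A F) (hmin _ (Finset.erase_ssubset hA))
    have h2 := Multiset.count_le_of_le x h1
    rw [Multiset.count_sum'] at h2
    have h3 : (F.erase A).card ≤ ∑ B ∈ F.erase A, B.count x := by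
      rw [Finset.card_eq_sum_ones]
      exact Finset.sum_le_sum fun B hB =>
        Multiset.one_le_count_iff_mem.2 (hall B (Finset.mem_of_mem_erase hB))
    rw [Finset.card_erase_of_mem hA] at h3
    have h4 := sum_count_le_card_add_delta (M := M) (S := {x}) (by
      simpa using Multiset.mem_of_le (hle A hA) (hall A hA))
    simp at h4
    omega

/-- A minimal unpackable family of pairs and triples has at most `Δ(M) + 3` members. -/
lemma card_le_delta_of_minimal {M : Multiset X} {F : Finset (Multiset X)}
    (hle : ∀ A ∈ F, A ≤ M) (hF : ∀ A ∈ F, A.card = 2 ∨ A.card = 3)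
    (hnot : ¬ IsPackable M F) (hmin : ∀ F' ⊂ F, IsPackable M F') :
    F.card ≤ delta M + 3 := by
  by_cases hP : ∃ P ∈ F, P.card = 2
  swap
  · push Not at hP
    have := card_le_delta_of_no_pairs hle (fun A hA => (hF A hA).resolve_left (hP A hA))
      hnot hmin
    omega
  obtain ⟨P, hPF, hP2⟩ := hP
  have hconn : ∀ W ⊆ F, W.Nonempty → W ≠ F → ∃ A ∈ W, ∃ B ∈ F \ W, ¬ Disjoint A B := by
    intro W hW hne hWF
    by_contra! h
    refine hnot (IsPackable.of_disjoint hW (hmin W (hW.ssubset_of_ne hWF))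
      (hmin _ (Finset.sdiff_ssubset hW hne)) h)
  obtain ⟨W, hWF, hWc, hsupp⟩ :=
    exists_card_support_le hF hconn F.card (Finset.card_pos.2 ⟨P, hPF⟩) le_rfl
  obtain rfl := Finset.eq_of_subset_of_card_le hWF hWc.ge
  obtain ⟨Q, g, hQ, hg, hi, hs⟩ := hmin _ (Finset.erase_ssubset hPF)
  have hQW : Q ⊆ W := hQ.trans (Finset.erase_subset _ _)
  have hPQ : P ∉ Q := fun h => (Finset.mem_erase.1 (hQ h)).1 rfl
  have hg' : ∀ A ∈ Q, A.card = 2 ∧ g A ∈ W ∧ (g A).card = 3 ∧ A ≤ g A := fun A hA =>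
    ⟨(hg A hA).1, Finset.mem_of_mem_erase (hg A hA).2.1, (hg A hA).2.2⟩
  have hQg : Disjoint Q (Q.image g) := by
    refine Finset.disjoint_left.2 fun A hA hA' => ?_
    obtain ⟨B, hB, rfl⟩ := Finset.mem_image.1 hA'
    have := (hg' _ hA).1; have := (hg' _ hB).2.2.1; omega
  have hQgW : Q ∪ Q.image g ⊆ W := by
    refine Finset.union_subset hQW fun A hA => ?_
    obtain ⟨B, hB, rfl⟩ := Finset.mem_image.1 hA
    exact (hg' B hB).2.1
  have hclasses : (W.image (containmentClass W)).card ≤ (W \ (Q ∪ Q.image g)).card := by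
    refine le_trans (Finset.card_le_card ?_) (Finset.card_image_le (f := containmentClass W))
    intro c hc
    by_contra hcn
    obtain ⟨B, hB, hBc⟩ := Finset.mem_image.1 hc
    have hmatched : ∀ A ∈ W, containmentClass W A = c → A ∈ Q ∪ Q.image g := by
      intro A hA hAc
      by_contra h
      exact hcn (Finset.mem_image.2 ⟨A, Finset.mem_sdiff.2 ⟨hA, h⟩, hAc⟩)
    let N := W.filter fun A => containmentClass W A = c ∧ A.card = 2
    have hN : ∀ A, A ∈ N ↔ A ∈ W ∧ containmentClass W A = c ∧ A.card = 2 := fun A =>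
      Finset.mem_filter
    have hNne : N.Nonempty := by
      rcases Finset.mem_union.1 (hmatched B hB hBc) with h | h
      · exact ⟨B, (hN B).2 ⟨hB, hBc, (hg' B h).1⟩⟩
      · obtain ⟨A, hA, rfl⟩ := Finset.mem_image.1 h
        obtain ⟨h1, h2, -, h3⟩ := hg' A hA
        exact ⟨A, (hN A).2 ⟨hQW hA, (containmentClass_eq (hQW hA) h2 h3).trans hBc, h1⟩⟩
    have hNQ : N ⊆ Q := by
      intro A hA
      obtain ⟨h1, h2, h3⟩ := (hN A).1 hA
      rcases Finset.mem_union.1 (hmatched A h1 h2) with h | h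
      · exact h
      · obtain ⟨C, hC, rfl⟩ := Finset.mem_image.1 h
        have := (hg' C hC).2.2.1; omega
    exact hnot (IsPackable.of_matched_class hN hNQ hg' hi
      (hmin _ (Finset.sdiff_ssubset (Finset.filter_subset _ _) hNne)))
  rw [Finset.card_sdiff_of_subset hQgW, Finset.card_union_of_disjoint hQg,
    Finset.card_image_of_injOn hi] at hclasses
  have hcardQ : Q.card + Q.card ≤ W.card := by
    have := Finset.card_le_card hQgW
    rwa [Finset.card_union_of_disjoint hQg, Finset.card_image_of_injOn hi] at this
  have hdelta := sum_count_le_card_add_delta (M := M)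
    (S := W.biUnion Multiset.toFinset) (by
      intro x hx
      obtain ⟨A, hA, hxA⟩ := Finset.mem_biUnion.1 hx
      exact Multiset.mem_toFinset.2 (Multiset.mem_of_le (hle A hA) (Multiset.mem_toFinset.1 hxA)))
  have htotal : ∑ A ∈ W.erase P \ Q, A.card ≤
      ∑ x ∈ W.biUnion Multiset.toFinset, M.count x := by
    calc ∑ A ∈ W.erase P \ Q, A.card
        = ∑ A ∈ W.erase P \ Q, ∑ x ∈ W.biUnion Multiset.toFinset, A.count x := by
          refine Finset.sum_congr rfl fun A hA => ?_
          rw [Multiset.sum_count_eq_card]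
          intro x hx
          exact Finset.mem_biUnion.2 ⟨A, Finset.mem_of_mem_erase (Finset.mem_sdiff.1 hA).1,
            Multiset.mem_toFinset.2 hx⟩
      _ = ∑ x ∈ W.biUnion Multiset.toFinset, ∑ A ∈ W.erase P \ Q, A.count x :=
          Finset.sum_comm
      _ ≤ _ := Finset.sum_le_sum fun x _ => by
          rw [← Multiset.count_sum']
          exact Multiset.count_le_of_le x hs
  have hcards : ∑ A ∈ W.erase P \ Q, A.card + 2 + 2 * Q.card =
      2 * W.card + (W.filter fun A => A.card = 3).card := by
    have h1 : ∑ A ∈ W, A.card = 2 * W.card + (W.filter fun A => A.card = 3).card := by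
      rw [Finset.card_filter, Finset.card_eq_sum_ones, Finset.mul_sum,
        ← Finset.sum_add_distrib]
      refine Finset.sum_congr rfl fun A hA => ?_
      rcases hF A hA with h | h <;> simp [h]
    have h2 : ∑ A ∈ Q, A.card = 2 * Q.card := by
      rw [Finset.sum_congr rfl fun A hA => (hg A hA).1]
      simp [mul_comm]
    rw [← h1, ← h2, ← Finset.add_sum_erase W _ hPF, ← Finset.sum_sdiff hQ, hP2]
    ring
  omega

end Packing
section ParentTree

variable {m : ℕ} {p : Fin m → Fin (m + 1)}

/-- The graph on `Fin (m + 1)` joining each `i.succ` to its parent `p i`. -/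
def parentGraph (p : Fin m → Fin (m + 1)) : SimpleGraph (Fin (m + 1)) :=
  SimpleGraph.fromEdgeSet (Set.range fun i => s(i.succ, p i))

lemma ne_parent (hp : ∀ i j, p i = j.succ → p j = 0) (i : Fin m) : i.succ ≠ p i := by
  intro h
  have := hp i i h.symm
  rw [this] at h
  exact Fin.succ_ne_zero i h

lemma parent_eq_zero_or (i : Fin m) : p i = 0 ∨ ∃ j, p i = Fin.succ j := by
  rcases Fin.eq_zero_or_eq_succ (p i) with h | ⟨j, h⟩
  · exact Or.inl h
  · exact Or.inr ⟨j, h⟩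

lemma parentGraph_adj (hp : ∀ i j, p i = j.succ → p j = 0) {u v : Fin (m + 1)} :
    (parentGraph p).Adj u v ↔ ∃ i, s(i.succ, p i) = s(u, v) := by
  rw [parentGraph, SimpleGraph.fromEdgeSet_adj]
  refine ⟨fun h => h.1, fun h => ⟨h, ?_⟩⟩
  rintro rfl
  obtain ⟨i, hi⟩ := h
  rcases Sym2.eq_iff.1 hi with ⟨h1, h2⟩ | ⟨h1, h2⟩ <;>
    exact ne_parent hp i (h1.trans h2.symm)

lemma parent_edge_injective (hp : ∀ i j, p i = j.succ → p j = 0) :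
    Function.Injective fun i => s(i.succ, p i) := by
  intro i j hij
  rcases Sym2.eq_iff.1 hij with ⟨h, -⟩ | ⟨h1, h2⟩
  · exact Fin.succ_injective _ h
  · have := hp i j h2
    rw [this] at h1
    exact absurd h1 (Fin.succ_ne_zero i)

lemma parentGraph_edgeFinset (hp : ∀ i j, p i = j.succ → p j = 0)
    [Fintype (parentGraph p).edgeSet] :
    (parentGraph p).edgeFinset =
      Finset.univ.map ⟨fun i => s(i.succ, p i), parent_edge_injective hp⟩ := by
  ext e
  induction e with
  | _ u v =>
    rw [SimpleGraph.mem_edgeFinset, SimpleGraph.mem_edgeSet, parentGraph_adj hp]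
    simp

lemma parentGraph_connected (hp : ∀ i j, p i = j.succ → p j = 0) :
    (parentGraph p).Connected := by
  have hadj : ∀ i, (parentGraph p).Reachable i.succ (p i) := fun i =>
    ((parentGraph_adj hp).2 ⟨i, rfl⟩).reachable
  have h0 : ∀ u, (parentGraph p).Reachable u 0 := by
    intro u
    rcases Fin.eq_zero_or_eq_succ u with rfl | ⟨i, rfl⟩
    · rfl
    · rcases parent_eq_zero_or (p := p) i with h | ⟨j, h⟩
      · exact h ▸ hadj i
      · have h1 := hadj i
        have h2 := hadj j
        rw [h] at h1
        rw [hp i j h] at h2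
        exact h1.trans h2
  exact ⟨fun u v => (h0 u).trans (h0 v).symm⟩

lemma parentGraph_isTree (hp : ∀ i j, p i = j.succ → p j = 0) :
    (parentGraph p).IsTree := by
  rw [SimpleGraph.isTree_iff_connected_and_card]
  refine ⟨parentGraph_connected hp, ?_⟩
  rw [Nat.card_eq_fintype_card, ← SimpleGraph.edgeFinset_card, parentGraph_edgeFinset hp]
  simp

/-- The vertices below the edge from `i.succ` to its parent. -/
lemma parentGraph_reachable_succ_iff (hp : ∀ i j, p i = j.succ → p j = 0) (i : Fin m)
    (w : Fin (m + 1)) :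
    ((parentGraph p).deleteEdges {s(i.succ, p i)}).Reachable i.succ w ↔
      w = i.succ ∨ ∃ j, w = j.succ ∧ p j = i.succ := by
  constructor
  · intro h
    rw [SimpleGraph.reachable_iff_reflTransGen] at h
    induction h with
    | refl => exact Or.inl rfl
    | @tail b c _ h ih =>
      rw [SimpleGraph.deleteEdges_adj, parentGraph_adj hp] at h
      obtain ⟨⟨k, hk⟩, hne⟩ := h
      have hki : k ≠ i := by
        rintro rfl
        exact hne hk.symm
      rcases Sym2.eq_iff.1 hk with ⟨rfl, rfl⟩ | ⟨rfl, rfl⟩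
      · rcases ih with h | ⟨j, hj, hji⟩
        · exact absurd (Fin.succ_injective _ h) hki
        · obtain rfl := Fin.succ_injective _ hj
          exact Or.inl hji
      · rcases ih with h | ⟨j, hj, hji⟩
        · exact Or.inr ⟨k, rfl, h⟩
        · have := hp k j hj
          rw [this] at hji
          exact absurd hji.symm (Fin.succ_ne_zero i)
  · rintro (rfl | ⟨j, rfl, hj⟩)
    · rfl
    · refine SimpleGraph.Adj.reachable ?_
      rw [SimpleGraph.deleteEdges_adj, parentGraph_adj hp]
      refine ⟨⟨j, by rw [hj, Sym2.eq_swap]⟩, fun h => ?_⟩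
      rw [Set.mem_singleton_iff] at h
      have h1 : s(j.succ, p j) = s(i.succ, p i) := by rw [hj, Sym2.eq_swap, h]
      have h2 := parent_edge_injective hp h1
      subst h2
      exact ne_parent hp j hj.symm

end ParentTree

section Sides

variable {V : Type*} {G : SimpleGraph V}

lemma reachable_deleteEdges_or (hG : G.Connected) (u v w : V) :
    (G.deleteEdges {s(u, v)}).Reachable u w ∨ (G.deleteEdges {s(u, v)}).Reachable v w := by
  have h := hG.preconnected u w
  rw [SimpleGraph.reachable_iff_reflTransGen] at h
  induction h with
  | refl => exact Or.inl (SimpleGraph.Reachable.refl _)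
  | @tail b c _ h ih =>
    by_cases hbc : s(b, c) = s(u, v)
    · rcases Sym2.eq_iff.1 hbc with ⟨-, rfl⟩ | ⟨-, rfl⟩
      · exact Or.inr (SimpleGraph.Reachable.refl _)
      · exact Or.inl (SimpleGraph.Reachable.refl _)
    · have : (G.deleteEdges {s(u, v)}).Adj b c := SimpleGraph.deleteEdges_adj.2 ⟨h, hbc⟩
      exact ih.imp (·.trans this.reachable) (·.trans this.reachable)

lemma not_reachable_deleteEdges (hG : G.IsAcyclic) {u v : V} (h : G.Adj u v) :
    ¬ (G.deleteEdges {s(u, v)}).Reachable u v :=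
  SimpleGraph.isBridge_iff.1 (SimpleGraph.isAcyclic_iff_forall_adj_isBridge.1 hG h)

lemma reachable_deleteEdges_comm_iff (hG : G.IsTree) {u v : V} (h : G.Adj u v) (w : V) :
    (G.deleteEdges {s(v, u)}).Reachable v w ↔ ¬ (G.deleteEdges {s(u, v)}).Reachable u w := by
  rw [Sym2.eq_swap]
  constructor
  · exact fun h1 h2 => not_reachable_deleteEdges hG.isAcyclic h (h2.trans h1.symm)
  · exact fun h1 => (reachable_deleteEdges_or hG.connected u v w).resolve_left h1

lemma reachable_deleteEdges_of_side (hG : G.IsTree) {u v x y : V} (huv : G.Adj u v)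
    (hxy : G.Adj x y) (hne : s(u, v) ≠ s(x, y))
    (hx : (G.deleteEdges {s(u, v)}).Reachable u x)
    (hu : (G.deleteEdges {s(x, y)}).Reachable x u) (w : V)
    (hw : (G.deleteEdges {s(v, u)}).Reachable v w) :
    (G.deleteEdges {s(x, y)}).Reachable x w := by
  have hy : (G.deleteEdges {s(u, v)}).Reachable u y :=
    hx.trans (SimpleGraph.Adj.reachable (SimpleGraph.deleteEdges_adj.2 ⟨hxy, hne.symm⟩))
  have hside := reachable_deleteEdges_comm_iff hG huv
  rw [SimpleGraph.reachable_iff_reflTransGen] at hw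
  induction hw with
  | refl =>
    exact hu.trans (SimpleGraph.Adj.reachable (SimpleGraph.deleteEdges_adj.2 ⟨huv, hne⟩))
  | @tail b c hb h ih =>
    rw [← SimpleGraph.reachable_iff_reflTransGen, hside] at hb
    refine ih.trans (SimpleGraph.Adj.reachable (SimpleGraph.deleteEdges_adj.2
      ⟨(SimpleGraph.deleteEdges_adj.1 h).1, fun hbc => hb ?_⟩))
    rcases Sym2.eq_iff.1 hbc with ⟨rfl, -⟩ | ⟨rfl, -⟩
    · exact hx
    · exact hy

/-- The sides of two distinct edges of a tree are nested, disjoint or jointly exhaustive. -/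
lemma sides_laminar (hG : G.IsTree) {u v x y : V} (huv : G.Adj u v)
    (hxy : G.Adj x y) (hne : s(u, v) ≠ s(x, y)) :
    (∀ w, (G.deleteEdges {s(u, v)}).Reachable u w → (G.deleteEdges {s(x, y)}).Reachable x w) ∨
    (∀ w, (G.deleteEdges {s(x, y)}).Reachable x w → (G.deleteEdges {s(u, v)}).Reachable u w) ∨
    (∀ w, (G.deleteEdges {s(u, v)}).Reachable u w →
      ¬ (G.deleteEdges {s(x, y)}).Reachable x w) ∨
    (∀ w, (G.deleteEdges {s(v, u)}).Reachable v w →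
      (G.deleteEdges {s(x, y)}).Reachable x w) := by
  have hne' : s(v, u) ≠ s(x, y) := by rwa [Sym2.eq_swap]
  have hne'' : s(u, v) ≠ s(y, x) := by rwa [Sym2.eq_swap (a := y)]
  have cuv := reachable_deleteEdges_comm_iff hG huv
  have cxy := reachable_deleteEdges_comm_iff hG hxy
  have hxyadj : (G.deleteEdges {s(u, v)}).Reachable x y :=
    SimpleGraph.Adj.reachable (SimpleGraph.deleteEdges_adj.2 ⟨hxy, hne.symm⟩)
  have huvadj : (G.deleteEdges {s(x, y)}).Reachable u v :=
    SimpleGraph.Adj.reachable (SimpleGraph.deleteEdges_adj.2 ⟨huv, hne⟩)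
  by_cases hx : (G.deleteEdges {s(u, v)}).Reachable u x <;>
    by_cases hu : (G.deleteEdges {s(x, y)}).Reachable x u
  · exact Or.inr (Or.inr (Or.inr
      (reachable_deleteEdges_of_side hG huv hxy hne hx hu)))
  · refine Or.inr (Or.inl fun w hw => ?_)
    have := reachable_deleteEdges_of_side hG huv hxy.symm hne'' (hx.trans hxyadj)
      ((cxy u).2 hu) w
    rw [cuv, cxy] at this
    tauto
  · exact Or.inl (reachable_deleteEdges_of_side hG huv.symm hxy hne' ((cuv x).2 hx)
      (hu.trans huvadj))
  · have huvadj' : (G.deleteEdges {s(y, x)}).Reachable u v := by rwa [Sym2.eq_swap]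
    have hxyadj' : (G.deleteEdges {s(v, u)}).Reachable x y := by rwa [Sym2.eq_swap]
    refine Or.inr (Or.inr (Or.inl fun w hw => (cxy w).1 ?_))
    exact reachable_deleteEdges_of_side hG huv.symm hxy.symm
      (by rwa [Sym2.eq_swap, Sym2.eq_swap (a := y)])
      (((cuv x).2 hx).trans hxyadj') (((cxy u).2 hu).trans huvadj') w hw

end Sides

section Representation

lemma MTree.isTree {X : Type} {M : Multiset X} (T : MTree X M) : T.G.IsTree :=
  ⟨T.connected, T.acyclic⟩

variable {X : Type} [DecidableEq X]

lemma MTree.part_swap {M : Multiset X} (T : MTree X M) {u v : Fin T.n} (h : T.G.Adj u v) :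
    T.part v u = M - T.part u v := by
  have hsum : T.part u v + T.part v u = M := by
    refine Eq.trans ?_ T.m1
    unfold MTree.part
    simp only [reachable_deleteEdges_comm_iff T.isTree h]
    exact Finset.sum_filter_add_sum_filter_not _ _ _
  exact eq_tsub_of_add_eq (by rw [add_comm, hsum])

/-- The tree built from a parent function of depth at most two. -/
lemma compatible_of_parent {M : Multiset X} {m : ℕ} {p : Fin m → Fin (m + 1)}
    (hp : ∀ i j, p i = j.succ → p j = 0) (A : Fin m → Multiset X)
    (htop : ∑ i with p i = 0, A i ≤ M) (hlt : ∀ i : Fin m, ∑ j with p j = i.succ, A j < A i)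
    (hroot : (Finset.univ.filter fun i => p i = 0).card ≤ 2 → ∑ i with p i = 0, A i ≠ M) :
    Compatible M (Finset.univ.val.map fun i => s(A i, M - A i)) := by
  have hT := parentGraph_isTree hp
  let label : Fin (m + 1) → Multiset X :=
    Fin.cons (M - ∑ i with p i = 0, A i) fun i => A i - ∑ j with p j = i.succ, A j
  have h0 : label 0 = M - ∑ i with p i = 0, A i := rfl
  have hs : ∀ i : Fin m, label i.succ = A i - ∑ j with p j = i.succ, A j := fun _ => rfl
  have hchild : ∀ i j : Fin m, p j = i.succ → label j.succ = A j := by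
    intro i j hj
    rw [hs, Finset.filter_eq_empty_iff.2, Finset.sum_empty, tsub_zero]
    intro k _ hk
    have := hp k j hk
    rw [this] at hj
    exact Fin.succ_ne_zero i hj.symm
  have hbelow : ∀ i : Fin m,
      label i.succ + ∑ j with p j = i.succ, label j.succ = A i := by
    intro i
    rw [Finset.sum_congr rfl fun j hj => hchild i j (Finset.mem_filter.1 hj).2, hs]
    exact tsub_add_cancel_of_le (hlt i).le
  have hm1 : ∑ v, label v = M := by
    rw [Fin.sum_univ_succ, ← Finset.sum_filter_add_sum_filter_not _ (fun i => p i = 0)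
      (fun i => label i.succ)]
    have h1 : ∑ j with ¬ p j = 0, label j.succ =
        ∑ i with p i = 0, ∑ j with p j = i.succ, label j.succ := by
      rw [Finset.sum_sigma']
      symm
      refine Finset.sum_bij (fun x _ => x.2) ?_ ?_ ?_ ?_
      · rintro ⟨i, j⟩ hij
        simp only [Finset.mem_sigma, Finset.mem_filter, Finset.mem_univ, true_and] at hij ⊢
        rw [hij.2]; exact Fin.succ_ne_zero i
      · rintro ⟨i, j⟩ hij ⟨i', j'⟩ hij' h
        simp only [Finset.mem_sigma, Finset.mem_filter, Finset.mem_univ, true_and] at hij hij'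
        obtain rfl : j = j' := h
        obtain rfl := Fin.succ_injective _ (hij.2.symm.trans hij'.2)
        rfl
      · intro j hj
        simp only [Finset.mem_filter, Finset.mem_univ, true_and] at hj
        obtain ⟨i, hi⟩ := (parent_eq_zero_or j).resolve_left hj
        exact ⟨⟨i, j⟩, by simp [hi, hp j i hi], rfl⟩
      · intro _ _; rfl
    rw [h1, ← Finset.sum_add_distrib, Finset.sum_congr rfl fun i _ => hbelow i, h0]
    exact tsub_add_cancel_of_le htop
  have hm2 : ∀ v, (parentGraph p).degree v = 1 ∨ (parentGraph p).degree v = 2 →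
      label v ≠ 0 := by
    intro v hv
    rcases Fin.eq_zero_or_eq_succ v with rfl | ⟨i, rfl⟩
    · have hdeg : (parentGraph p).degree 0 = (Finset.univ.filter fun i => p i = 0).card := by
        rw [← SimpleGraph.card_neighborFinset_eq_degree,
          ← Finset.card_map (Fin.succEmb m)]
        congr 1
        ext v
        rw [SimpleGraph.mem_neighborFinset, parentGraph_adj hp]
        simp only [Finset.mem_map, Finset.mem_filter, Finset.mem_univ, true_and]
        refine exists_congr fun i => ?_
        rw [Sym2.eq_iff]
        simp only [Fin.succ_ne_zero, false_and, false_or, Fin.coe_succEmb]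
        tauto
      rw [hdeg] at hv
      rw [h0]
      intro h
      exact hroot (by omega) (le_antisymm htop (tsub_eq_zero_iff_le.1 h))
    · rw [hs]
      intro h
      exact (hlt i).not_ge (tsub_eq_zero_iff_le.1 h)
  let T : MTree X M := ⟨m + 1, parentGraph p, hT.connected, hT.isAcyclic, label, hm1, by
    convert hm2⟩
  have hpart : ∀ i : Fin m, T.part i.succ (p i) = A i := by
    intro i
    rw [← hbelow i]
    change ∑ w ∈ Finset.univ.filter (fun w =>
      ((parentGraph p).deleteEdges {s(i.succ, p i)}).Reachable i.succ w), label w = _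
    simp only [parentGraph_reachable_succ_iff hp]
    have : (Finset.univ.filter fun w : Fin (m + 1) =>
        w = i.succ ∨ ∃ j, w = j.succ ∧ p j = i.succ) =
        insert i.succ ((Finset.univ.filter fun j => p j = i.succ).map (Fin.succEmb m)) := by
      ext w
      simp only [Finset.mem_filter, Finset.mem_univ, true_and, Finset.mem_insert,
        Finset.mem_map, Fin.coe_succEmb]
      refine or_congr Iff.rfl (exists_congr fun j => ?_)
      rw [and_comm, eq_comm (a := w)]
    rw [this, Finset.sum_insert, Finset.sum_map]
    · rfl
    · simp only [Finset.mem_map, Finset.mem_filter, Finset.mem_univ, true_and,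
        Fin.coe_succEmb, not_exists, not_and]
      intro j hj hji
      obtain rfl := Fin.succ_injective _ hji
      exact ne_parent hp j hj.symm
  refine ⟨T, ?_⟩
  unfold MTree.splits
  change Multiset.map _ (parentGraph p).edgeFinset.val = _
  rw [parentGraph_edgeFinset hp, Finset.map_val, Multiset.map_map]
  refine Multiset.map_congr rfl fun i _ => ?_
  have hadj : T.G.Adj i.succ (p i) := (parentGraph_adj hp).2 ⟨i, rfl⟩
  change s(T.part i.succ (p i), T.part (p i) i.succ) = _
  rw [T.part_swap hadj, hpart]

lemma compatible_of_isPackable {M : Multiset X} {F : Finset (Multiset X)}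
    (hM : 7 ≤ M.card) (hF : ∀ A ∈ F, A.card = 2 ∨ A.card = 3) (h : IsPackable M F) :
    Compatible M (F.val.map fun A => s(A, M - A)) := by
  obtain ⟨Q, g, hQ, hg, hi, hs⟩ := h
  let e := F.equivFin
  let A : Fin F.card → Multiset X := fun i => (e.symm i : Multiset X)
  have hAF : ∀ i, A i ∈ F := fun i => (e.symm i).2
  have hAinj : Function.Injective A := Subtype.val_injective.comp e.symm.injective
  have hAe : ∀ B (hB : B ∈ F), A (e ⟨B, hB⟩) = B := fun B hB => by simp [A]
  have hmap : (Finset.univ : Finset (Fin F.card)).map ⟨A, hAinj⟩ = F := by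
    ext B
    simp only [Finset.mem_map, Finset.mem_univ, true_and, Function.Embedding.coeFn_mk]
    exact ⟨fun ⟨i, hi⟩ => hi ▸ hAF i, fun hB => ⟨e ⟨B, hB⟩, hAe B hB⟩⟩
  let p : Fin F.card → Fin (F.card + 1) := fun i =>
    if hiQ : A i ∈ Q then (e ⟨g (A i), (hg _ hiQ).2.1⟩).succ else 0
  have hp0 : ∀ i, p i = 0 ↔ A i ∉ Q := by
    intro i
    by_cases hiQ : A i ∈ Q <;> simp [p, hiQ, Fin.succ_ne_zero]
  have hpA : ∀ i j, p i = j.succ → A i ∈ Q ∧ g (A i) = A j := by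
    intro i j hij
    have hiQ : A i ∈ Q := by
      by_contra hiQ
      rw [(hp0 i).2 hiQ] at hij
      exact Fin.succ_ne_zero j hij.symm
    refine ⟨hiQ, ?_⟩
    simp only [p, hiQ, dif_pos] at hij
    rw [← Fin.succ_injective _ hij, hAe]
  have hp : ∀ i j, p i = j.succ → p j = 0 := by
    intro i j hij
    obtain ⟨hiQ, hgi⟩ := hpA i j hij
    rw [hp0]
    intro hj
    have h1 := (hg _ hj).1
    have h2 := (hg _ hiQ).2.2.1
    rw [hgi] at h2
    omega
  have htopmap : (Finset.univ.filter fun i => p i = 0).map ⟨A, hAinj⟩ = F \ Q := by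
    ext B
    simp only [Finset.mem_map, Finset.mem_filter, Finset.mem_univ, true_and, hp0,
      Function.Embedding.coeFn_mk, Finset.mem_sdiff]
    constructor
    · rintro ⟨i, hi, rfl⟩
      exact ⟨hAF i, hi⟩
    · rintro ⟨hB, hBQ⟩
      exact ⟨e ⟨B, hB⟩, by rwa [hAe], hAe B hB⟩
  have htop : ∑ i with p i = 0, A i = ∑ B ∈ F \ Q, B := by
    rw [← htopmap, Finset.sum_map]
    rfl
  have key := compatible_of_parent (M := M) hp A (htop ▸ hs) ?_ ?_
  · convert key using 1
    conv_lhs => rw [← hmap]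
    rw [Finset.map_val, Multiset.map_map]
    rfl
  · intro i
    rcases (Finset.univ.filter fun j => p j = i.succ).eq_empty_or_nonempty with h | ⟨j, hj⟩
    · rw [h, Finset.sum_empty, pos_iff_ne_zero]
      rintro h0
      have := hF _ (hAF i)
      rw [h0, Multiset.card_zero] at this
      omega
    · have hj' := (Finset.mem_filter.1 hj).2
      have hsing : (Finset.univ.filter fun j => p j = i.succ) = {j} := by
        refine Finset.eq_singleton_iff_unique_mem.2 ⟨hj, fun k hk => ?_⟩
        have hk' := (Finset.mem_filter.1 hk).2
        obtain ⟨h1, h2⟩ := hpA _ _ hj'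
        obtain ⟨h3, h4⟩ := hpA _ _ hk'
        exact hAinj (hi h3 h1 (h4.trans h2.symm))
      rw [hsing, Finset.sum_singleton]
      obtain ⟨h1, h2⟩ := hpA _ _ hj'
      obtain ⟨h3, -, h4, h5⟩ := hg _ h1
      rw [h2] at h4 h5
      refine lt_of_le_of_ne h5 fun h => ?_
      rw [h] at h3
      omega
  · intro hcard hMeq
    have h1 : M.card = ∑ i with p i = 0, (A i).card := by
      rw [← hMeq, Multiset.card_sum]
    have h2 := Finset.sum_le_card_nsmul (Finset.univ.filter fun i => p i = 0)
      (fun i => (A i).card) 3 (fun i _ => by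
        rcases hF _ (hAF i) with h | h <;> simp [h])
    rw [smul_eq_mul] at h2
    omega

lemma isPackable_of_compatible {M : Multiset X} {F : Finset (Multiset X)}
    (hle : ∀ A ∈ F, A ≤ M) (hF : ∀ A ∈ F, A.card = 2 ∨ A.card = 3)
    (hhalf : ∀ A ∈ F, 2 * A.card ≤ M.card)
    (hinj : Set.InjOn (fun A => s(A, M - A)) (F : Set (Multiset X)))
    (h : Compatible M (F.val.map fun A => s(A, M - A))) : IsPackable M F := by
  obtain ⟨T, hT⟩ := h
  have : Nonempty (Fin T.n) := T.connected.nonempty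
  have hedge : ∀ A ∈ F, ∃ u v, T.G.Adj u v ∧ T.part u v = A := by
    intro A hA
    have hmem : s(A, M - A) ∈ T.splits := by
      rw [hT]
      exact Multiset.mem_map_of_mem (fun A => s(A, M - A)) hA
    obtain ⟨e, he, heA⟩ := Multiset.mem_map.1 hmem
    induction e with
    | _ a b =>
      have hab : T.G.Adj a b :=
        (SimpleGraph.mem_edgeSet _).1 (SimpleGraph.mem_edgeFinset.1 he)
      rcases Sym2.eq_iff.1 heA with ⟨h1, -⟩ | ⟨-, h1⟩
      · exact ⟨a, b, hab, h1⟩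
      · exact ⟨b, a, hab.symm, h1⟩
  choose! u v hadj hpart using hedge
  let D : Multiset X → Finset (Fin T.n) := fun A =>
    Finset.univ.filter fun w => (T.G.deleteEdges {s(u A, v A)}).Reachable (u A) w
  have hmemD : ∀ A w, w ∈ D A ↔ (T.G.deleteEdges {s(u A, v A)}).Reachable (u A) w :=
    fun A w => by simp [D]
  have hDsum : ∀ A ∈ F, ∑ w ∈ D A, T.label w = A := hpart
  have hmono : ∀ A ∈ F, ∀ B ∈ F, D A ⊆ D B → A ≤ B := by
    intro A hA B hB hAB
    rw [← hDsum A hA, ← hDsum B hB]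
    exact Finset.sum_le_sum_of_subset hAB
  have hlam : ∀ A ∈ F, ∀ B ∈ F, A ≠ B → D A ⊆ D B ∨ D B ⊆ D A ∨ Disjoint (D A) (D B) := by
    intro A hA B hB hAB
    have hne : s(u A, v A) ≠ s(u B, v B) := by
      intro h
      refine hAB (hinj hA hB ?_)
      have hsplit : ∀ C ∈ F, s(C, M - C) = Sym2.lift ⟨fun u v => s(T.part u v, T.part v u),
          fun u v => Sym2.eq_swap⟩ s(u C, v C) := by
        intro C hC
        rw [Sym2.lift_mk]
        simp only
        rw [T.part_swap (hadj C hC), hpart C hC]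
      simp only
      rw [hsplit A hA, hsplit B hB, h]
    rcases sides_laminar T.isTree (hadj A hA) (hadj B hB) hne with h | h | h | h
    · exact Or.inl fun w hw => (hmemD B w).2 (h w ((hmemD A w).1 hw))
    · exact Or.inr (Or.inl fun w hw => (hmemD A w).2 (h w ((hmemD B w).1 hw)))
    · exact Or.inr (Or.inr (Finset.disjoint_left.2 fun w hw hw' =>
        h w ((hmemD A w).1 hw) ((hmemD B w).1 hw')))
    · exfalso
      have hcompl : M - A ≤ B := by
        rw [← hpart A hA, ← T.part_swap (hadj A hA)]
        conv_rhs => rw [← hDsum B hB]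
        refine Finset.sum_le_sum_of_subset fun w hw => (hmemD B w).2 (h w ?_)
        simpa using hw
      have hAM := Multiset.card_sub (hle A hA)
      have h1 := Multiset.card_le_card hcompl
      have h2 := hhalf A hA
      have h3 := hhalf B hB
      have hBA : M - A = B := Multiset.eq_of_le_of_card_le hcompl (by omega)
      have hAB' : M - B = A := by
        rw [← hBA, tsub_tsub_cancel_of_le (hle A hA)]
      refine hAB (hinj hA hB ?_)
      simp only
      rw [hBA, hAB', Sym2.eq_swap]
  have hsub : ∀ A ∈ F, ∀ B ∈ F, A ≠ B → D A ⊆ D B → A.card = 2 ∧ B.card = 3 := by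
    intro A hA B hB hne hAB
    have := Multiset.card_lt_card (lt_of_le_of_ne (hmono A hA B hB hAB) hne)
    have := hF A hA
    have := hF B hB
    omega
  have hex : ∀ A, A ∈ F.filter (fun A => ∃ T ∈ F, T ≠ A ∧ D A ⊆ D T) →
      ∃ T ∈ F, T ≠ A ∧ D A ⊆ D T := fun A hA => (Finset.mem_filter.1 hA).2
  choose! g hgF hgne hgD using hex
  refine ⟨F.filter (fun A => ∃ T ∈ F, T ≠ A ∧ D A ⊆ D T), g, Finset.filter_subset _ _,
    ?_, ?_, ?_⟩
  · intro A hA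
    have hAF := (Finset.mem_filter.1 hA).1
    have := hsub A hAF _ (hgF A hA) (hgne A hA).symm (hgD A hA)
    exact ⟨this.1, hgF A hA, this.2, hmono A hAF _ (hgF A hA) (hgD A hA)⟩
  · intro A hA B hB hAB
    by_contra hne
    have hAF := (Finset.mem_filter.1 hA).1
    have hBF := (Finset.mem_filter.1 hB).1
    have h1 := hsub A hAF _ (hgF A hA) (hgne A hA).symm (hgD A hA)
    have h2 := hsub B hBF _ (hgF B hB) (hgne B hB).symm (hgD B hB)
    have hdisj : Disjoint (D A) (D B) := by
      rcases hlam A hAF B hBF hne with h | h | h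
      · have := hsub A hAF B hBF hne h; omega
      · have := hsub B hBF A hAF (Ne.symm hne) h; omega
      · exact h
    have hle' : A + B ≤ g A := by
      rw [← hDsum _ (hgF A hA)]
      conv_lhs => rw [← hDsum A hAF, ← hDsum B hBF, ← Finset.sum_union hdisj]
      exact Finset.sum_le_sum_of_subset
        (Finset.union_subset (hgD A hA) (hAB ▸ hgD B hB))
    have := Multiset.card_le_card hle'
    rw [Multiset.card_add] at this
    omega
  · have hpair : ∀ A ∈ F \ F.filter (fun A => ∃ T ∈ F, T ≠ A ∧ D A ⊆ D T),
        A ∈ F ∧ ∀ B ∈ F, B ≠ A → ¬ D A ⊆ D B := by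
      intro A hA
      simp only [Finset.mem_sdiff, Finset.mem_filter, not_and, not_exists] at hA
      exact ⟨hA.1, fun B hB hBA => hA.2 hA.1 B hB hBA⟩
    rw [Finset.sum_congr rfl fun A hA => (hDsum A (hpair A hA).1).symm,
      ← Finset.sum_biUnion]
    · exact (Finset.sum_le_sum_of_subset (Finset.subset_univ _)).trans_eq T.m1
    · intro A hA B hB hne
      obtain ⟨hAF, hA'⟩ := hpair A hA
      obtain ⟨hBF, hB'⟩ := hpair B hB
      rcases hlam A hAF B hBF hne with h | h | h
      · exact absurd h (hA' B hBF hne.symm)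
      · exact absurd h (hB' A hAF hne)
      · exact h

end Representation

section Main

variable {X : Type} [DecidableEq X]

lemma triple_unique_of_isPackable {M : Multiset X} {F F' : Finset (Multiset X)}
    (hM : M.card ≤ 6)
    (hinj : Set.InjOn (fun A => s(A, M - A)) (F : Set (Multiset X))) (hF' : F' ⊆ F)
    (h : IsPackable M F') {A B : Multiset X} (hA : A ∈ F') (hB : B ∈ F')
    (hA3 : A.card = 3) (hB3 : B.card = 3) : A = B := by
  obtain ⟨Q, g, -, hg, -, hs⟩ := h
  by_contra hne
  have hnot : ∀ C : Multiset X, C.card = 3 → C ∉ Q := fun C hC hCQ => by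
    have := (hg C hCQ).1; omega
  have hle : A + B ≤ M := by
    refine le_trans ?_ hs
    rw [← Finset.sum_pair (f := fun D : Multiset X => D) hne]
    exact Finset.sum_le_sum_of_subset (by
      simp [Finset.insert_subset_iff, hA, hB, hnot A hA3, hnot B hB3])
  have hMeq : A + B = M := Multiset.eq_of_le_of_card_le hle (by
    rw [Multiset.card_add]; omega)
  refine hne (hinj (hF' hA) (hF' hB) ?_)
  simp only
  rw [← hMeq, add_tsub_cancel_left, add_tsub_cancel_right, Sym2.eq_swap]

lemma card_le_three_of_isPackable {M : Multiset X} {F F' : Finset (Multiset X)}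
    (hM : M.card ≤ 6) (hF : ∀ A ∈ F, A.card = 2 ∨ A.card = 3)
    (hinj : Set.InjOn (fun A => s(A, M - A)) (F : Set (Multiset X))) (hF' : F' ⊆ F)
    (h : IsPackable M F') : F'.card ≤ 3 := by
  have huniq := fun {A B} => triple_unique_of_isPackable hM hinj hF' h (A := A) (B := B)
  obtain ⟨Q, g, hQ, hg, hi, hs⟩ := h
  have hcard := Multiset.card_le_card hs
  rw [Multiset.card_sum] at hcard
  have htwo : ∀ S ⊆ F', S.card * 2 ≤ ∑ A ∈ S, A.card := fun S hS => by
    rw [← smul_eq_mul]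
    refine Finset.card_nsmul_le_sum _ _ _ fun A hA => ?_
    rcases hF A (hF' (hS hA)) with h | h <;> simp [h]
  have hQ1 : Q.card ≤ 1 := Finset.card_le_one.2 fun A hA B hB =>
    hi hA hB (huniq (hg A hA).2.1 (hg B hB).2.1 (hg A hA).2.2.1 (hg B hB).2.2.1)
  have hsd := Finset.card_sdiff_of_subset hQ
  rcases Q.eq_empty_or_nonempty with rfl | ⟨A, hA⟩
  · have := htwo (F' \ ∅) Finset.sdiff_subset
    simp only [Finset.card_empty] at hsd
    omega
  · obtain ⟨-, h1, h2, -⟩ := hg A hA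
    have hmem : g A ∈ F' \ Q := Finset.mem_sdiff.2 ⟨h1, fun h => by
      have := (hg _ h).1; omega⟩
    have h3 := htwo ((F' \ Q).erase (g A)) ((Finset.erase_subset _ _).trans Finset.sdiff_subset)
    rw [Finset.card_erase_of_mem hmem] at h3
    rw [← Finset.add_sum_erase _ _ hmem, h2] at hcard
    omega

/-- Small ground multisets: all proper subfamilies packable already bounds the size. -/
lemma card_le_delta_of_card_le_six {M : Multiset X} {F : Finset (Multiset X)}
    (hM : M.card ≤ 6) (hF : ∀ A ∈ F, A.card = 2 ∨ A.card = 3)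
    (hinj : Set.InjOn (fun A => s(A, M - A)) (F : Set (Multiset X)))
    (hmin : ∀ F' ⊂ F, IsPackable M F') : F.card ≤ delta M + 3 := by
  by_contra! hlt
  have hle3 : ∀ F' ⊂ F, F'.card ≤ 3 := fun F' hF' =>
    card_le_three_of_isPackable hM hF hinj hF'.subset (hmin F' hF')
  obtain ⟨A₀, hA₀⟩ : F.Nonempty := Finset.card_pos.1 (by omega)
  have h4 : F.card = 4 := by
    have := hle3 _ (Finset.erase_ssubset hA₀)
    rw [Finset.card_erase_of_mem hA₀] at this
    omega
  have hnodup : M.Nodup := by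
    rw [Multiset.nodup_iff_count_le_one]
    intro x
    by_cases hx : x ∈ M
    · have h1 := sum_count_le_card_add_delta (M := M) (S := {x}) (by simpa using hx)
      simp at h1
      omega
    · rw [Multiset.count_eq_zero.2 hx]; omega
  by_cases hT : ∃ T ∈ F, T.card = 3
  · obtain ⟨T, hTF, hT3⟩ := hT
    have hpairs : ∀ A ∈ F, A ≠ T → A.card = 2 := by
      intro A hA hne
      refine (hF A hA).resolve_right fun hA3 => hne ?_
      have hsub : ({A, T} : Finset (Multiset X)) ⊆ F := by
        simp [Finset.insert_subset_iff, hA, hTF]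
      refine triple_unique_of_isPackable hM hinj hsub (hmin _ (hsub.ssubset_of_ne ?_))
        (by simp) (by simp) hA3 hT3
      intro h
      have := Finset.card_pair hne
      rw [h] at this
      omega
    have hexcl : ∀ B : Multiset X, B.card = 2 → B ≤ T → ¬ B + T ≤ M := by
      intro B hB hBT hBM
      obtain ⟨x, hx⟩ := Multiset.card_pos_iff_exists_mem.1 (by omega : 0 < B.card)
      have h1 := Multiset.nodup_iff_count_le_one.1 hnodup x
      have h2 := Multiset.count_le_of_le x hBM
      rw [Multiset.count_add] at h2
      have h3 := Multiset.one_le_count_iff_mem.2 hx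
      have h4 := Multiset.one_le_count_iff_mem.2 (Multiset.mem_of_le hBT hx)
      omega
    have hkey : ∀ P ∈ F, P ≠ T →
        (∃ B ∈ F, B ≠ P ∧ B ≠ T ∧ B ≤ T) ∧ ∃ C ∈ F, C ≠ P ∧ C ≠ T ∧ C + T ≤ M := by
      intro P hP hPT
      obtain ⟨Q, g, hQ, hg, hi, hs⟩ := hmin _ (Finset.erase_ssubset hP)
      have hTQ : T ∉ Q := fun h => by
        have := (hg T h).1; omega
      have hTP : T ∈ F.erase P := Finset.mem_erase.2 ⟨hPT.symm, hTF⟩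
      have hc2 : ((F.erase P).erase T).card = 2 := by
        rw [Finset.card_erase_of_mem hTP, Finset.card_erase_of_mem hP, h4]
      have hgT : ∀ B ∈ Q, g B = T := by
        intro B hB
        by_contra h
        have h1 := hpairs (g B) (Finset.mem_of_mem_erase (hg B hB).2.1) h
        have h2 := (hg B hB).2.2.1
        omega
      rcases Q.eq_empty_or_nonempty with rfl | ⟨B, hB⟩
      · exfalso
        have hcard := Multiset.card_le_card hs
        rw [Multiset.card_sum, Finset.sdiff_empty, ← Finset.add_sum_erase _ _ hTP,
          Finset.sum_congr rfl fun A hA => hpairs A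
            (Finset.mem_of_mem_erase (Finset.mem_of_mem_erase hA)) (Finset.mem_erase.1 hA).1,
          Finset.sum_const, hc2, hT3] at hcard
        simp at hcard
        omega
      · have hBT : B ≠ T := fun h => hTQ (h ▸ hB)
        obtain ⟨hBP, hBF⟩ := Finset.mem_erase.1 (hQ hB)
        refine ⟨⟨B, hBF, hBP, hBT, hgT B hB ▸ (hg B hB).2.2.2⟩, ?_⟩
        obtain ⟨C, hC⟩ : (((F.erase P).erase T).erase B).Nonempty := by
          rw [← Finset.card_pos, Finset.card_erase_of_mem
            (Finset.mem_erase.2 ⟨hBT, hQ hB⟩), hc2]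
          omega
        simp only [Finset.mem_erase] at hC
        obtain ⟨hCB, hCT, hCP, hCF⟩ := hC
        have hCQ : C ∉ Q := fun h => hCB (hi h hB ((hgT C h).trans (hgT B hB).symm))
        refine ⟨C, hCF, hCP, hCT, le_trans ?_ hs⟩
        rw [← Finset.sum_pair (f := fun D : Multiset X => D) hCT]
        refine Finset.sum_le_sum_of_subset ?_
        simp [Finset.insert_subset_iff, hCP, hCF, hCQ, hPT.symm, hTF, hTQ]
    obtain ⟨P, hP⟩ : (F.erase T).Nonempty := by
      rw [← Finset.card_pos, Finset.card_erase_of_mem hTF]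
      omega
    obtain ⟨hPT, hPF⟩ := Finset.mem_erase.1 hP
    obtain ⟨⟨B, hBF, -, hBT, hB⟩, -⟩ := hkey P hPF hPT
    obtain ⟨⟨B', hBF', hBB', hBT', hB'⟩, C, hCF, hCB, hCT, hC⟩ := hkey B hBF hBT
    obtain ⟨-, C', hCF', hCC', hCT', hC'⟩ := hkey C hCF hCT
    have hne : ∀ D E, D ∈ F → D ≠ T → D ≤ T → E + T ≤ M → D ≠ E := by
      rintro D E hD hDT hDle hE rfl
      exact hexcl D (hpairs D hD hDT) hDle hE
    have hsub : ({T, B, B', C, C'} : Finset (Multiset X)) ⊆ F := by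
      simp [Finset.insert_subset_iff, *]
    have hfive : ({T, B, B', C, C'} : Finset (Multiset X)).card = 5 := by
      rw [Finset.card_insert_of_notMem, Finset.card_insert_of_notMem,
        Finset.card_insert_of_notMem, Finset.card_pair hCC'.symm]
      · simp [hne B' C hBF' hBT' hB' hC, hne B' C' hBF' hBT' hB' hC']
      · simp [hne B C hBF hBT hB hC, hne B C' hBF hBT hB hC', hBB'.symm]
      · simp [hBT.symm, hBT'.symm, hCT.symm, hCT'.symm]
    have := Finset.card_le_card hsub
    omega
  · push Not at hT
    have hF2 : ∀ A ∈ F, A.card = 2 := fun A hA => (hF A hA).resolve_right (hT A hA)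
    have hsum : ∀ P ∈ F, ∑ A ∈ F.erase P, A = M := by
      intro P hP
      obtain ⟨Q, g, -, hg, -, hs⟩ := hmin _ (Finset.erase_ssubset hP)
      have hQ : Q = ∅ := Finset.eq_empty_of_forall_notMem fun A hA =>
        hT _ (Finset.mem_of_mem_erase (hg A hA).2.1) (hg A hA).2.2.1
      rw [hQ, Finset.sdiff_empty] at hs
      refine Multiset.eq_of_le_of_card_le hs ?_
      rw [Multiset.card_sum, Finset.sum_congr rfl fun A hA =>
        hF2 A (Finset.mem_of_mem_erase hA), Finset.sum_const, Finset.card_erase_of_mem hP, h4]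
      simpa using hM
    have hone : F.card ≤ 1 := by
      refine Finset.card_le_one.2 fun A hA B hB => ?_
      have h1 := Finset.add_sum_erase F (fun C => C) hA
      have h2 := Finset.add_sum_erase F (fun C => C) hB
      rw [hsum A hA] at h1
      rw [hsum B hB, ← h1] at h2
      exact (add_right_cancel h2).symm
    omega

lemma exists_small_part {M : Multiset X} {S : Sym2 (Multiset X)} (h : IsSplit M S) :
    ∃ A, s(A, M - A) = S ∧ A ≤ M ∧ A.card = splitSize S ∧ 2 * A.card ≤ M.card := by
  obtain ⟨A, B, rfl, -, -, rfl⟩ := h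
  change ∃ C : Multiset X, _ ∧ _ ∧ C.card = min A.card B.card ∧ _
  rw [Multiset.card_add]
  rcases le_total A.card B.card with h | h
  · exact ⟨A, by rw [add_tsub_cancel_left], Multiset.le_add_right _ _, by omega, by omega⟩
  · exact ⟨B, by rw [add_tsub_cancel_right, Sym2.eq_swap], Multiset.le_add_left _ _,
      by omega, by omega⟩

end Main

/-- Proposition. Suppose `𝔉` is an incompatible 2,3-split system
on `M` containing `k ≥ 3` splits, in which every split has multiplicity 1, such that
every proper subset of `𝔉` is compatible. Then `Δ(M) ≥ k - 3`. -/
theorem stmt13 {X : Type} [DecidableEq X] (M : Multiset X)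
    (𝔉 : Multiset (Sym2 (Multiset X))) (hsys : IsSplitSystem M 𝔉)
    (h23 : ∀ S ∈ 𝔉, splitSize S = 2 ∨ splitSize S = 3)
    (hmult : ∀ S ∈ 𝔉, 𝔉.count S = 1)
    (hcard : 3 ≤ Multiset.card 𝔉) (hincomp : ¬ Compatible M 𝔉)
    (hproper : ∀ 𝔉' : Multiset (Sym2 (Multiset X)), 𝔉' < 𝔉 → Compatible M 𝔉') :
    Multiset.card 𝔉 - 3 ≤ delta M := by
  have hex : ∀ S ∈ 𝔉, ∃ A, s(A, M - A) = S ∧ A ≤ M ∧ A.card = splitSize S ∧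
      2 * A.card ≤ M.card := fun S hS => exists_small_part (hsys S hS)
  choose! σ hσ hσM hσc hσ2 using hex
  have hnd : 𝔉.Nodup := by
    rw [Multiset.nodup_iff_count_le_one]
    intro S
    by_cases hS : S ∈ 𝔉
    · exact (hmult S hS).le
    · rw [Multiset.count_eq_zero.2 hS]; omega
  let F : Finset (Multiset X) := ⟨𝔉.map σ, hnd.map_on fun S hS S' hS' h => by
    rw [← hσ S hS, ← hσ S' hS', h]⟩
  have hmem : ∀ A ∈ F, ∃ S ∈ 𝔉, σ S = A := fun A hA => Multiset.mem_map.1 hA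
  have hmap : F.val.map (fun A => s(A, M - A)) = 𝔉 := by
    change (𝔉.map σ).map _ = 𝔉
    rw [Multiset.map_map]
    exact (Multiset.map_congr rfl fun S hS => hσ S hS).trans (Multiset.map_id 𝔉)
  have hFcard : F.card = Multiset.card 𝔉 := Multiset.card_map σ 𝔉
  have hle : ∀ A ∈ F, A ≤ M := by
    intro A hA
    obtain ⟨S, hS, rfl⟩ := hmem A hA
    exact hσM S hS
  have hF : ∀ A ∈ F, A.card = 2 ∨ A.card = 3 := by
    intro A hA
    obtain ⟨S, hS, rfl⟩ := hmem A hA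
    rw [hσc S hS]
    exact h23 S hS
  have hhalf : ∀ A ∈ F, 2 * A.card ≤ M.card := by
    intro A hA
    obtain ⟨S, hS, rfl⟩ := hmem A hA
    exact hσ2 S hS
  have hinj : Set.InjOn (fun A => s(A, M - A)) (F : Set (Multiset X)) := by
    intro A hA B hB hAB
    obtain ⟨S, hS, rfl⟩ := hmem A hA
    obtain ⟨S', hS', rfl⟩ := hmem B hB
    simp only [hσ S hS, hσ S' hS'] at hAB
    rw [hAB]
  have hmin : ∀ F' ⊂ F, IsPackable M F' := by
    intro F' hF'
    refine isPackable_of_compatible (fun A hA => hle A (hF'.subset hA))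
      (fun A hA => hF A (hF'.subset hA)) (fun A hA => hhalf A (hF'.subset hA))
      (hinj.mono (Finset.coe_subset.2 hF'.subset)) (hproper _ (lt_of_le_of_ne ?_ ?_))
    · rw [← hmap]
      exact Multiset.map_le_map (Finset.val_le_iff.2 hF'.subset)
    · intro h
      have h1 := congrArg Multiset.card h
      rw [Multiset.card_map] at h1
      have h2 := Finset.card_lt_card hF'
      rw [hFcard, ← h1] at h2
      exact lt_irrefl _ h2
  have hbound : F.card ≤ delta M + 3 := by
    rcases le_or_gt M.card 6 with hM | hM
    · exact card_le_delta_of_card_le_six hM hF hinj hmin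
    · refine card_le_delta_of_minimal hle hF (fun h => hincomp ?_) hmin
      rw [← hmap]
      exact compatible_of_isPackable hM hF h
  omega
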